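/- Let V be a finite-dimensional real normed vector space and let (A_i)_{i ∈ I} be a locally finite family of affine subspaces of V, each of codimension at least 2 in V. Then the complement V \ ⋃_{i ∈ I} A_i is path-connected (and hence nonempty if dim V ≥ 2). -/

import Mathlib

/-- In a finite-dimensional real normed space, a countable family of proper affine subspaces does
not cover the space. -/
theorem AffineSubspace.exists_forall_notMem_of_countable
    {V : Type*} [NormedAddCommGroup V] [NormedSpace ℝ V] [FiniteDimensional ℝ V]
    {J : Type*} [Countable J] (B : J → AffineSubspace ℝ V) (hB : ∀ j, B j ≠ ⊤) :
    ∃ z, ∀ j, z ∉ B j := by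
  borelize V
  have hae : ∀ᵐ z ∂(MeasureTheory.Measure.addHaar : MeasureTheory.Measure V), ∀ j, z ∉ B j :=
    MeasureTheory.ae_all_iff.2 fun j =>
      MeasureTheory.measure_eq_zero_iff_ae_notMem.1
        (MeasureTheory.Measure.addHaar_affineSubspace _ (B j) (hB j))
  exact hae.exists

/-- Adjoining a point to an affine subspace of codimension at least 2 does not span the space. -/
theorem AffineSubspace.affineSpan_insert_ne_top_of_codim_two
    {V : Type*} [NormedAddCommGroup V] [NormedSpace ℝ V] [FiniteDimensional ℝ V]
    (A : AffineSubspace ℝ V)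
    (hA : Module.finrank ℝ A.direction + 2 ≤ Module.finrank ℝ V) (a : V) :
    affineSpan ℝ (insert a (A : Set V)) ≠ ⊤ := by
  intro h
  have hle := finrank_vectorSpan_insert_le A a
  rw [← direction_affineSpan, h, AffineSubspace.direction_top, finrank_top] at hle
  omega

/-- A segment issued from a point outside an affine subspace avoids this subspace as soon as its
other endpoint is outside the span of the subspace and the point. -/
theorem AffineSubspace.disjoint_segment_of_notMem_affineSpan_insert
    {V : Type*} [AddCommGroup V] [Module ℝ V] (A : AffineSubspace ℝ V) {a z : V}
    (ha : a ∉ A) (hz : z ∉ affineSpan ℝ (insert a (A : Set V))) :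
    Disjoint (segment ℝ a z) (A : Set V) := by
  rw [Set.disjoint_left]
  intro p hp hpA
  rw [segment_eq_image_lineMap] at hp
  obtain ⟨t, -, rfl⟩ := hp
  have ht : t ≠ 0 := by
    rintro rfl
    exact ha (by simpa using hpA)
  refine hz ?_
  have hmem := AffineMap.lineMap_mem (t⁻¹)
    (subset_affineSpan ℝ _ (Set.mem_insert a (A : Set V)))
    (subset_affineSpan ℝ _ (Set.mem_insert_of_mem a hpA))
  simpa [AffineMap.lineMap_apply, smul_smul, ht] using hmem

/-- The complement in a finite-dimensional real normed space of a countable union of affine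
subspaces of codimension at least 2 is path-connected. -/
theorem AffineSubspace.isPathConnected_compl_iUnion_of_countable
    {V : Type*} [NormedAddCommGroup V] [NormedSpace ℝ V] [FiniteDimensional ℝ V]
    {J : Type*} [Countable J] (A : J → AffineSubspace ℝ V)
    (hcodim : ∀ j, Module.finrank ℝ (A j).direction + 2 ≤ Module.finrank ℝ V) :
    IsPathConnected (⋃ j, (A j : Set V))ᶜ := by
  have htop (j : J) (a : V) := (A j).affineSpan_insert_ne_top_of_codim_two (hcodim j) a
  have hjoin {a z : V} (ha : a ∈ (⋃ j, (A j : Set V))ᶜ)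
      (hz : ∀ j, z ∉ affineSpan ℝ (insert a (A j : Set V))) :
      JoinedIn (⋃ j, (A j : Set V))ᶜ a z := by
    refine JoinedIn.of_segment_subset ?_
    rw [Set.subset_compl_iff_disjoint_right, Set.disjoint_iUnion_right]
    exact fun j => (A j).disjoint_segment_of_notMem_affineSpan_insert
      (fun h => ha (Set.mem_iUnion_of_mem j h)) (hz j)
  rw [isPathConnected_iff]
  constructor
  · obtain ⟨z, hz⟩ := exists_forall_notMem_of_countable _ fun j => htop j 0
    exact ⟨z, by
      rw [Set.mem_compl_iff, Set.mem_iUnion]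
      exact fun ⟨j, hj⟩ => hz j (subset_affineSpan ℝ _ (Set.mem_insert_of_mem _ hj))⟩
  · intro a ha b hb
    obtain ⟨z, hz⟩ := exists_forall_notMem_of_countable
      (Sum.elim (fun j => affineSpan ℝ (insert a (A j : Set V)))
        fun j => affineSpan ℝ (insert b (A j : Set V)))
      (Sum.rec (fun j => htop j a) fun j => htop j b)
    exact (hjoin ha fun j => hz (.inl j)).trans (hjoin hb fun j => hz (.inr j)).symm


/-- The complement in a finite-dimensional real normed vector space of a
locally finite union of affine subspaces of codimension at least 2 is
path-connected. -/
theorem compl_locallyFinite_union_affine_codim_two_isPathConnected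
    {V : Type*} [NormedAddCommGroup V] [NormedSpace ℝ V] [FiniteDimensional ℝ V]
    {I : Type*} (A : I → AffineSubspace ℝ V)
    (hcodim : ∀ i, Module.finrank ℝ (A i).direction + 2 ≤ Module.finrank ℝ V)
    (hlf : LocallyFinite fun i => (A i : Set V)) :
    IsPathConnected (⋃ i, (A i : Set V))ᶜ := by
  let J := {i // (A i : Set V).Nonempty}
  have hJ : Countable J := Set.countable_univ_iff.1
    ((hlf.comp_injective Subtype.val_injective).countable_univ fun j : J => j.2)
  have hUnion : ⋃ i, (A i : Set V) = ⋃ j : J, (A j : Set V) := by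
    ext x
    simp only [Set.mem_iUnion]
    exact ⟨fun ⟨i, hi⟩ => ⟨⟨i, x, hi⟩, hi⟩, fun ⟨j, hj⟩ => ⟨j, hj⟩⟩
  rw [hUnion]
  exact AffineSubspace.isPathConnected_compl_iUnion_of_countable _ fun j : J => hcodim j
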